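/- Let κ > 0, s > 1, C₀ > 0, C₁ > 0. Then there exists C > 0, depending only on κ, s, C₀, C₁, and for every B > 0 there exist δ > 0 and u₀ ≤ −1, depending only on κ, s, C₀, C₁, B, such that the following holds. Let A < A′ be reals with e^{−2κA} − e^{−2κA′} ≤ δ, let D = {(u, v) ∈ ℝ² : A ≤ u + v ≤ A′, u ≤ u₀, v ≥ 1}, and let Ψ : ℝ² → ℝ be twice continuously differentiable on a neighborhood of D. Assume for every (u, v) ∈ D: (i) |∂_v Ψ(A − v, v)| ≤ B (v − A)^{−s} whenever (A − v, v) ∈ D; (ii) |∂_u Ψ(u, v)| ≤ 2B (−u)^{−s}; (iii) e^{−κ(v+u)} |Ψ(u, v)| ≤ C₁ B e^{−κA} (−u)^{−s}; (iv) |∂_u ∂_v Ψ(u, v)| ≤ C₀ ( e^{−2κ(v+u)} (|Ψ(u, v)| + |∂_u Ψ(u, v)| + |∂_v Ψ(u, v)|) + |∂_u Ψ(u, v)| · |∂_v Ψ(u, v)| ). Then |∂_v Ψ(u, v)| ≤ C B (v − A)^{−s} for every (u, v) ∈ D. -/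

import Mathlib

/-- The partial derivative of `Ψ : ℝ × ℝ → ℝ` in the first (`u`) direction. -/
noncomputable def pdU (Ψ : ℝ × ℝ → ℝ) (p : ℝ × ℝ) : ℝ := fderiv ℝ Ψ p (1, 0)

/-- The partial derivative of `Ψ : ℝ × ℝ → ℝ` in the second (`v`) direction. -/
noncomputable def pdV (Ψ : ℝ × ℝ → ℝ) (p : ℝ × ℝ) : ℝ := fderiv ℝ Ψ p (0, 1)

/-- The mixed partial derivative `∂_u ∂_v Ψ` of `Ψ : ℝ × ℝ → ℝ`. -/
noncomputable def pdUV (Ψ : ℝ × ℝ → ℝ) (p : ℝ × ℝ) : ℝ :=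
  fderiv ℝ (fun q => fderiv ℝ Ψ q (0, 1)) p (1, 0)

open Set in
/-- A differential form of Grönwall's inequality, with explicit primitives `E`, `G` of the
coefficients. -/
theorem abs_le_exp_mul_of_abs_deriv_le {f f' E E' G G' g : ℝ → ℝ} {a b M : ℝ}
    (hf : ∀ x ∈ Icc a b, HasDerivAt f (f' x) x)
    (hE : ∀ x ∈ Icc a b, HasDerivAt E (E' x) x)
    (hG : ∀ x ∈ Icc a b, HasDerivAt G (G' x) x)
    (hE0 : ∀ x ∈ Icc a b, 0 ≤ E x) (hG0 : 0 ≤ G a) (hM : 0 ≤ M) (hfa : |f a| ≤ M)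
    (hG' : ∀ x ∈ Icc a b, 0 ≤ G' x) (hg : ∀ x ∈ Icc a b, g x < G' x)
    (bound : ∀ x ∈ Icc a b, |f' x| ≤ E' x * |f x| + g x) {x : ℝ} (hx : x ∈ Icc a b) :
    |f x| ≤ Real.exp (E x) * (M + G x) := by
  have hder : ∀ x ∈ Icc a b, HasDerivAt (fun x => Real.exp (E x) * (M + G x))
      (Real.exp (E x) * E' x * (M + G x) + Real.exp (E x) * G' x) x := fun x hx =>
    (hE x hx).exp.mul ((hG x hx).const_add M)
  have hab : a ≤ b := hx.1.trans hx.2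
  refine image_norm_le_of_norm_deriv_right_lt_deriv_boundary' (f := f) (f' := f')
    (fun x hx => (hf x hx).continuousAt.continuousWithinAt)
    (fun x hx => (hf x (Ico_subset_Icc_self hx)).hasDerivWithinAt) ?_
    (fun x hx => (hder x hx).continuousAt.continuousWithinAt)
    (fun x hx => (hder x (Ico_subset_Icc_self hx)).hasDerivWithinAt) ?_ hx
  · have h1 := Real.one_le_exp (hE0 a (left_mem_Icc.2 hab))
    rw [Real.norm_eq_abs]
    nlinarith
  · intro x hx hfx
    have hx' := Ico_subset_Icc_self hx
    rw [Real.norm_eq_abs] at hfx ⊢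
    have h1 := Real.one_le_exp (hE0 x hx')
    have h2 := bound x hx'
    have h3 := hg x hx'
    have h4 : G' x ≤ Real.exp (E x) * G' x := le_mul_of_one_le_left (hG' x hx') h1
    rw [hfx] at h2
    linarith

/-- An exponential weight compensates a translation of a negative power. -/
theorem exp_mul_rpow_neg_le {κ s x y : ℝ} (hκ : 0 < κ) (hs : 0 < s) (hx : 0 ≤ x) (hy : 1 ≤ y) :
    Real.exp (-(κ * x)) * y ^ (-s) ≤
      (1 + 2 * s / κ) ^ s * Real.exp (-(κ / 2 * x)) * (y + x) ^ (-s) := by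
  have hy0 : 0 < y := by linarith
  have h1 : y + x ≤ y * ((1 + 2 * s / κ) * Real.exp (κ * x / (2 * s))) := by
    have h2 : 1 + x ≤ (1 + 2 * s / κ) * Real.exp (κ * x / (2 * s)) := by
      calc 1 + x ≤ 1 + x + (2 * s / κ + κ * x / (2 * s)) := by
            have : 0 ≤ 2 * s / κ + κ * x / (2 * s) := by positivity
            linarith
        _ = (1 + 2 * s / κ) * (κ * x / (2 * s) + 1) := by field_simp; ring
        _ ≤ _ := by gcongr; exact Real.add_one_le_exp _
    calc y + x ≤ y * (1 + x) := by nlinarith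
      _ ≤ _ := by gcongr
  have h3 : (y + x) ^ s ≤ y ^ s * ((1 + 2 * s / κ) ^ s * Real.exp (κ / 2 * x)) := by
    have h4 : Real.exp (κ * x / (2 * s)) ^ s = Real.exp (κ / 2 * x) := by
      rw [← Real.exp_mul]; congr 1; field_simp
    calc (y + x) ^ s ≤ (y * ((1 + 2 * s / κ) * Real.exp (κ * x / (2 * s)))) ^ s := by gcongr
      _ = _ := by
        rw [Real.mul_rpow hy0.le (by positivity),
          Real.mul_rpow (by positivity) (Real.exp_pos _).le, h4]
  have hexp : Real.exp (-(κ * x)) = Real.exp (-(κ / 2 * x)) * Real.exp (-(κ / 2 * x)) := by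
    rw [← Real.exp_add]; congr 1; ring
  have h5 : 0 < y ^ s := by positivity
  have h6 : 0 < (y + x) ^ s := by positivity
  rw [Real.rpow_neg hy0.le, Real.rpow_neg (by positivity), hexp, Real.exp_neg]
  have h7 : (y ^ s)⁻¹ ≤
      (1 + 2 * s / κ) ^ s * Real.exp (κ / 2 * x) * ((y + x) ^ s)⁻¹ := by
    rw [inv_le_iff_one_le_mul₀ h5, ← div_eq_mul_inv, div_mul_eq_mul_div, one_le_div h6]
    linarith
  calc _ ≤ (Real.exp (κ / 2 * x))⁻¹ * (Real.exp (κ / 2 * x))⁻¹ *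
        ((1 + 2 * s / κ) ^ s * Real.exp (κ / 2 * x) * ((y + x) ^ s)⁻¹) := by gcongr
    _ = _ := by field_simp

/-- The right-hand side of the wave equation, bounded by an integrable coefficient times
`|∂_v Ψ|` plus an exponentially decaying multiple of `(v - A) ^ (-s)`. -/
theorem blueshift_coefficient_bound {κ s C₀ C₁ A B t v X Y Z F : ℝ} (hκ : 0 < κ) (hs : 0 < s)
    (hC₀ : 0 < C₀) (hC₁ : 0 < C₁) (hB : 0 < B) (hY : 0 ≤ Y) (hZ : 0 ≤ Z)
    (hA : A ≤ v + t) (ht : 1 ≤ -t) (h2 : Y ≤ 2 * B * (-t) ^ (-s))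
    (h3 : Real.exp (-(κ * (v + t))) * X ≤ C₁ * B * Real.exp (-(κ * A)) * (-t) ^ (-s))
    (h1 : F ≤ C₀ * (Real.exp (-(2 * κ * (v + t))) * (X + Y + Z) + Y * Z)) :
    F ≤ (C₀ * Real.exp (-(2 * κ * (v + t))) + 2 * C₀ * B * (-t) ^ (-s)) * Z +
      C₀ * (C₁ + 2) * B * Real.exp (-(2 * κ * A)) * (1 + 2 * s / κ) ^ s * (v - A) ^ (-s) *
        Real.exp (-(κ / 2 * (v + t - A))) := by
  have h4 := exp_mul_rpow_neg_le hκ hs (show 0 ≤ v + t - A by linarith) ht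
  rw [show -t + (v + t - A) = v - A by ring] at h4
  set K : ℝ := (1 + 2 * s / κ) ^ s
  set W : ℝ := (v - A) ^ (-s)
  set a : ℝ := Real.exp (-(2 * κ * A)) with ha
  have hapos : 0 < a := Real.exp_pos _
  set T : ℝ := (-t) ^ (-s)
  have hT : 0 < T := Real.rpow_pos_of_pos (by linarith) _
  set e : ℝ := Real.exp (-(κ * (v + t - A)))
  have he0 : 0 < e := Real.exp_pos _
  set q : ℝ := Real.exp (-(κ * (v + t))) with hq
  have hq0 : 0 < q := Real.exp_pos _
  have hq2 : Real.exp (-(2 * κ * (v + t))) = q * q := by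
    rw [hq, ← Real.exp_add]; congr 1; ring
  have hqe : q * Real.exp (-(κ * A)) = a * e := by
    rw [hq, ha, ← Real.exp_add, ← Real.exp_add]; congr 1; ring
  have hqq : q * q ≤ a * e := by
    rw [← hqe]
    gcongr
    rw [hq, Real.exp_le_exp]
    nlinarith
  have hψ : q * q * X ≤ C₁ * B * (a * (e * T)) := by
    calc q * q * X = q * (q * X) := by ring
      _ ≤ q * (C₁ * B * Real.exp (-(κ * A)) * T) := by gcongr
      _ = C₁ * B * (q * Real.exp (-(κ * A)) * T) := by ring
      _ = _ := by rw [hqe]; ring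
  have hψu : q * q * Y ≤ 2 * B * (a * (e * T)) := by
    calc q * q * Y ≤ a * e * (2 * B * T) := by gcongr
      _ = _ := by ring
  have hprod : Y * Z ≤ 2 * B * T * Z := by gcongr
  rw [hq2] at h1
  rw [hq2]
  calc F
      ≤ C₀ * (q * q * X + q * q * Y + q * q * Z +
        Y * Z) := by linarith
    _ ≤ C₀ * (C₁ * B * (a * (e * T)) + 2 * B * (a * (e * T)) + q * q * Z +
        2 * B * T * Z) := by gcongr
    _ = (C₀ * (q * q) + 2 * C₀ * B * T) * Z +
        C₀ * (C₁ + 2) * B * a * (e * T) := by ring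
    _ ≤ (C₀ * (q * q) + 2 * C₀ * B * T) * Z +
        C₀ * (C₁ + 2) * B * a * (K * Real.exp (-(κ / 2 * (v + t - A))) * W) := by gcongr
    _ = _ := by ring

/-- Differentiating `∂_v Ψ` along a `u`-line gives `∂_u ∂_v Ψ`. -/
theorem hasDerivAt_pdV {Ψ : ℝ × ℝ → ℝ} {u v : ℝ} (h : ContDiffAt ℝ 2 Ψ (u, v)) :
    HasDerivAt (fun t => pdV Ψ (t, v)) (pdUV Ψ (u, v)) u := by
  have h1 : ContDiffAt ℝ 1 (fderiv ℝ Ψ) (u, v) := h.fderiv_right (by norm_num)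
  have h2 : DifferentiableAt ℝ (fun q => fderiv ℝ Ψ q (0, 1)) (u, v) :=
    (h1.differentiableAt (by norm_num)).clm_apply (differentiableAt_const _)
  have h3 : HasDerivAt (fun t : ℝ => (t, v)) ((1, 0) : ℝ × ℝ) u :=
    (hasDerivAt_id u).prodMk (hasDerivAt_const u v)
  exact h2.hasFDerivAt.comp_hasDerivAt u h3

theorem exists_one_le_rpow_neg_le {r ε : ℝ} (hr : 0 < r) (hε : 0 < ε) :
    ∃ R : ℝ, 1 ≤ R ∧ R ^ (-r) ≤ ε := by
  have h := (tendsto_rpow_neg_atTop hr).eventually (eventually_le_nhds hε)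
  obtain ⟨R, h1, h2⟩ := (h.and (Filter.eventually_ge_atTop 1)).exists
  exact ⟨R, h2, h1⟩

/-- abstract form of Proposition 8.9, 'BS.rvP', of Luk–Oh: the estimate
for `∂_v Ψ` in a blue-shift sub-region near the Cauchy horizon. -/
theorem blueshift_dv_estimate (κ s C₀ C₁ : ℝ)
    (hκ : 0 < κ) (hs : 1 < s) (hC₀ : 0 < C₀) (hC₁ : 0 < C₁) :
    ∃ C > 0, ∀ B : ℝ, 0 < B → ∃ δ > 0, ∃ u₀ : ℝ, u₀ ≤ -1 ∧
      ∀ (A A' : ℝ), A < A' →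
        Real.exp (-(2 * κ * A)) - Real.exp (-(2 * κ * A')) ≤ δ →
      ∀ (D : Set (ℝ × ℝ)),
        D = {p : ℝ × ℝ | A ≤ p.1 + p.2 ∧ p.1 + p.2 ≤ A' ∧ p.1 ≤ u₀ ∧ 1 ≤ p.2} →
      ∀ (Ψ : ℝ × ℝ → ℝ) (N : Set (ℝ × ℝ)),
        IsOpen N → D ⊆ N → ContDiffOn ℝ 2 Ψ N →
        -- (i) data bound on {u + v = A}
        (∀ v : ℝ, (A - v, v) ∈ D → |pdV Ψ (A - v, v)| ≤ B * (v - A) ^ (-s)) →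
        -- (ii) bootstrap bound on ∂_u Ψ
        (∀ p ∈ D, |pdU Ψ p| ≤ 2 * B * (-p.1) ^ (-s)) →
        -- (iii) pointwise estimate for Ψ
        (∀ p ∈ D, Real.exp (-(κ * (p.2 + p.1))) * |Ψ p|
          ≤ C₁ * B * Real.exp (-(κ * A)) * (-p.1) ^ (-s)) →
        -- (iv) schematic wave equation
        (∀ p ∈ D, |pdUV Ψ p| ≤
          C₀ * (Real.exp (-(2 * κ * (p.2 + p.1))) * (|Ψ p| + |pdU Ψ p| + |pdV Ψ p|)
            + |pdU Ψ p| * |pdV Ψ p|)) →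
        -- conclusion
        ∀ p ∈ D, |pdV Ψ p| ≤ C * B * (p.2 - A) ^ (-s) := by
  set K : ℝ := (1 + 2 * s / κ) ^ s with hK
  have hs0 : 0 < s := by linarith
  have hs1 : 0 < s - 1 := by linarith
  have hKpos : 0 < K := by positivity
  refine ⟨Real.exp 1 * (1 + 4 / κ * (C₀ * (C₁ + 2) * K)), by positivity, fun B hB => ?_⟩
  obtain ⟨R, hR1, hR⟩ := exists_one_le_rpow_neg_le hs1
    (show 0 < (s - 1) / (4 * C₀ * B) by positivity)
  refine ⟨min 1 (κ / C₀), by positivity, -R, by linarith, ?_⟩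
  rintro A A' hAA' hδ D rfl Ψ N hN hDN hΨ hdata hboot hptw hwave ⟨u, v⟩ ⟨hu1, hu2, hu3, hv⟩
  simp only at hu1 hu2 hu3 hv
  have hD : ∀ t ∈ Set.Icc (A - v) u,
      (t, v) ∈ {p : ℝ × ℝ | A ≤ p.1 + p.2 ∧ p.1 + p.2 ≤ A' ∧ p.1 ≤ -R ∧ 1 ≤ p.2} :=
    fun t ht => ⟨by linarith [ht.1], by linarith [ht.2], by linarith [ht.2], hv⟩
  have hle : A - v ≤ u := by linarith
  have hw : 1 ≤ v - A := by linarith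
  have hw0 : 0 < v - A := by linarith
  set W : ℝ := (v - A) ^ (-s) with hW
  have hWpos : 0 < W := Real.rpow_pos_of_pos hw0 _
  set a : ℝ := Real.exp (-(2 * κ * A)) with ha
  have hapos : 0 < a := Real.exp_pos _
  set P : ℝ := C₀ * (C₁ + 2) * B * a * K * W with hP
  have hPpos : 0 < P := by positivity
  let E : ℝ → ℝ := fun t => C₀ / (2 * κ) * (a - Real.exp (-(2 * κ * (v + t)))) +
    2 * C₀ * B / (s - 1) * ((-t) ^ (1 - s) - (v - A) ^ (1 - s))
  let E' : ℝ → ℝ := fun t => C₀ * Real.exp (-(2 * κ * (v + t))) + 2 * C₀ * B * (-t) ^ (-s)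
  let G : ℝ → ℝ := fun t => 4 * P / κ * (1 - Real.exp (-(κ / 2 * (v + t - A))))
  let G' : ℝ → ℝ := fun t => 2 * P * Real.exp (-(κ / 2 * (v + t - A)))
  let g : ℝ → ℝ := fun t => P * Real.exp (-(κ / 2 * (v + t - A)))
  have hE : ∀ t ∈ Set.Icc (A - v) u, HasDerivAt E (E' t) t := by
    intro t ht
    have ht0 : 0 < -t := by linarith [ht.2]
    have h1 : HasDerivAt (fun t => Real.exp (-(2 * κ * (v + t))))
        (Real.exp (-(2 * κ * (v + t))) * (-(2 * κ * 1))) t :=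
      (((hasDerivAt_id t).const_add v).const_mul (2 * κ)).neg.exp
    have h2 : HasDerivAt (fun t : ℝ => (-t) ^ (1 - s)) (-1 * (1 - s) * (-t) ^ (1 - s - 1)) t :=
      (hasDerivAt_id t).neg.rpow_const (Or.inl ht0.ne')
    have h3 := ((h1.const_sub a).const_mul (C₀ / (2 * κ))).add
      ((h2.sub_const ((v - A) ^ (1 - s))).const_mul (2 * C₀ * B / (s - 1)))
    refine h3.congr_deriv ?_
    rw [show 1 - s - 1 = -s by ring]
    simp only [E']
    field_simp
    ring
  have hG : ∀ t ∈ Set.Icc (A - v) u, HasDerivAt G (G' t) t := by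
    intro t _
    have h1 : HasDerivAt (fun t => Real.exp (-(κ / 2 * (v + t - A))))
        (Real.exp (-(κ / 2 * (v + t - A))) * (-(κ / 2 * 1))) t :=
      ((((hasDerivAt_id t).const_add v).sub_const A).const_mul (κ / 2)).neg.exp
    refine ((h1.const_sub 1).const_mul (4 * P / κ)).congr_deriv ?_
    simp only [G']
    field_simp
    ring
  have hexp_le : ∀ t ∈ Set.Icc (A - v) u, Real.exp (-(2 * κ * (v + t))) ≤ a := by
    intro t ht
    rw [ha, Real.exp_le_exp]
    nlinarith [ht.1]
  have hE0 : ∀ t ∈ Set.Icc (A - v) u, 0 ≤ E t := by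
    intro t ht
    have ht0 : 0 < -t := by linarith [ht.2]
    have h1 := hexp_le t ht
    have h2 : (v - A) ^ (1 - s) ≤ (-t) ^ (1 - s) :=
      Real.rpow_le_rpow_of_nonpos ht0 (by linarith [ht.1]) (by linarith)
    have h3 := sub_nonneg.2 h1
    have h4 := sub_nonneg.2 h2
    simp only [E]
    positivity
  have hbound : ∀ t ∈ Set.Icc (A - v) u,
      |pdUV Ψ (t, v)| ≤ E' t * |pdV Ψ (t, v)| + g t := by
    intro t ht
    exact blueshift_coefficient_bound hκ hs0 hC₀ hC₁ hB (abs_nonneg _) (abs_nonneg _)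
      (show A ≤ v + t by linarith [ht.1]) (by linarith [ht.2]) (hboot _ (hD t ht))
      (hptw _ (hD t ht)) (hwave _ (hD t ht))
  have hmain := abs_le_exp_mul_of_abs_deriv_le (f := fun t => pdV Ψ (t, v)) (M := B * W)
    (fun t ht => hasDerivAt_pdV (hΨ.contDiffAt (hN.mem_nhds (hDN (hD t ht))))) hE hG hE0
    (by simp [G]) (by positivity) (hdata v (hD _ ⟨le_rfl, hle⟩))
    (fun t _ => by simp only [G']; positivity)
    (fun t _ => by
      have : 0 < P * Real.exp (-(κ / 2 * (v + t - A))) := by positivity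
      simp only [g, G']
      linarith)
    hbound (Set.right_mem_Icc.2 hle)
  have hA' : Real.exp (-(2 * κ * A')) ≤ Real.exp (-(2 * κ * (v + u))) := by
    rw [Real.exp_le_exp]
    nlinarith
  have hEu : E u ≤ 1 := by
    have h1 : C₀ / (2 * κ) * (a - Real.exp (-(2 * κ * (v + u)))) ≤ 1 / 2 := by
      calc _ ≤ C₀ / (2 * κ) * (κ / C₀) := by
            gcongr
            linarith [min_le_right 1 (κ / C₀)]
        _ = 1 / 2 := by field_simp
    have h2 : (-u) ^ (1 - s) ≤ (s - 1) / (4 * C₀ * B) := by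
      rw [show -(s - 1) = 1 - s by ring] at hR
      exact (Real.rpow_le_rpow_of_nonpos (by linarith) (by linarith) (by linarith)).trans hR
    have h3 : 0 < (v - A) ^ (1 - s) := Real.rpow_pos_of_pos hw0 _
    have h4 : 2 * C₀ * B / (s - 1) * ((-u) ^ (1 - s) - (v - A) ^ (1 - s)) ≤ 1 / 2 := by
      calc _ ≤ 2 * C₀ * B / (s - 1) * ((s - 1) / (4 * C₀ * B)) := by
            gcongr
            linarith
        _ = 1 / 2 := by field_simp; norm_num
    simp only [E]
    linarith
  have hGu : G u ≤ 4 / κ * (C₀ * (C₁ + 2) * K) * (B * W) := by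
    have h1 : a * (1 - Real.exp (-(κ / 2 * (v + u - A)))) ≤ 1 := by
      calc a * (1 - Real.exp (-(κ / 2 * (v + u - A))))
          ≤ a * (1 - Real.exp (-(2 * κ * (v + u - A)))) := by
            gcongr
            · linarith
            · linarith
        _ = a - Real.exp (-(2 * κ * (v + u))) := by
            rw [mul_sub, mul_one, ha, ← Real.exp_add]; congr 2; ring
        _ ≤ 1 := by linarith [min_le_left 1 (κ / C₀)]
    calc G u = 4 / κ * (C₀ * (C₁ + 2) * K) * (B * W) *
          (a * (1 - Real.exp (-(κ / 2 * (v + u - A))))) := by simp only [G, hP]; ring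
      _ ≤ _ := mul_le_of_le_one_right (by positivity) h1
  have hGnn : 0 ≤ G u := by
    have : Real.exp (-(κ / 2 * (v + u - A))) ≤ 1 :=
      Real.exp_le_one_iff.2 (by nlinarith)
    have := sub_nonneg.2 this
    simp only [G]
    positivity
  calc |pdV Ψ (u, v)| ≤ Real.exp (E u) * (B * W + G u) := hmain
    _ ≤ Real.exp 1 * (B * W + 4 / κ * (C₀ * (C₁ + 2) * K) * (B * W)) := by gcongr
    _ = _ := by ring
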